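/- arXiv:2111.10324 — 2 statements merged into one kernel-verified Lean document; each statement's English description precedes it below -/
import Mathlib

section
/- For any positive integer r, the quaternary quadratic form x² + y² + z² + 2^{2r-1} t² represents every positive integer n that is represented by it over ℤ_p for all primes p (i.e., it is a regular quadratic form). -/
def Sum3 (n : ℤ) : Prop := ∃ x y z : ℤ, x ^ 2 + y ^ 2 + z ^ 2 = n

lemma exists_shift (a d : ℤ) (ha : 0 < a) : ∃ k : ℤ, 2 * (d + k * a) ≤ a ∧ -a ≤ 2 * (d + k * a) := by
  refine ⟨-((2 * d + a) / (2 * a)), ?_⟩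
  have h1 := Int.emod_add_mul_ediv (2 * d + a) (2 * a)
  have h2 := Int.emod_nonneg (2 * d + a) (b := 2 * a) (by omega)
  have h3 := Int.emod_lt_of_pos (2 * d + a) (b := 2 * a) (by omega)
  generalize (2 * d + a) / (2 * a) = q at *
  generalize (2 * d + a) % (2 * a) = s at *
  constructor <;> nlinarith

lemma reduced_case (a b c d e f : ℤ) (ha : 0 < a) (hg : 0 < a * b - d ^ 2)
    (hdet : (a * b - d ^ 2) * (a * c - e ^ 2) - (a * f - d * e) ^ 2 = a)
    (hd1 : 2 * d ≤ a) (hd2 : -a ≤ 2 * d) (he1 : 2 * e ≤ a) (he2 : -a ≤ 2 * e)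
    (hf1 : 2 * (a * f - d * e) ≤ a * b - d ^ 2) (hf2 : -(a * b - d ^ 2) ≤ 2 * (a * f - d * e))
    (hab : a ≤ b) (hgg : a * b - d ^ 2 ≤ a * c - e ^ 2) :
    a = 1 ∧ b = 1 ∧ c = 1 ∧ d = 0 ∧ e = 0 ∧ f = 0 := by
  have h1 : 4 * d ^ 2 ≤ a ^ 2 := by nlinarith
  have h2 : 4 * (a * f - d * e) ^ 2 ≤ (a * b - d ^ 2) ^ 2 := by nlinarith
  have h3 : 3 * a ^ 2 ≤ 4 * (a * b - d ^ 2) := by nlinarith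
  have h4 : 3 * (a * b - d ^ 2) ^ 2 ≤ 4 * a := by nlinarith
  have a1 : a = 1 := by
    by_contra hne
    have : 2 ≤ a := by omega
    generalize a * b - d ^ 2 = g at *
    have h5 : 9 * a ^ 4 ≤ 16 * g ^ 2 := by
      have : (3 * a ^ 2) ^ 2 ≤ (4 * g) ^ 2 := by gcongr
      nlinarith
    have h6 : 27 * a ^ 3 ≤ 64 := by
      have : a * (27 * a ^ 3) ≤ a * 64 := by nlinarith
      exact le_of_mul_le_mul_left this ha
    have h7 : (2 : ℤ) ^ 3 ≤ a ^ 3 := by gcongr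
    omega
  subst a1
  have d0 : d = 0 := by omega
  have e0 : e = 0 := by omega
  subst d0 e0
  simp at *
  have b1 : b = 1 := by nlinarith
  subst b1
  have f0 : f = 0 := by omega
  subst f0
  simp at hdet
  simp [hdet]

theorem form_sum3 : ∀ N M : ℕ, ∀ a b c d e f : ℤ, a.toNat = N → (a * b - d ^ 2).toNat = M →
    0 < a → 0 < a * b - d ^ 2 →
    (a * b - d ^ 2) * (a * c - e ^ 2) - (a * f - d * e) ^ 2 = a →
    ∀ x y z : ℤ, Sum3 (a * x ^ 2 + b * y ^ 2 + c * z ^ 2 + 2 * d * x * y + 2 * e * x * z + 2 * f * y * z) := by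
  intro N
  induction N using Nat.strong_induction_on with
  | _ N ihN =>
  intro M
  induction M using Nat.strong_induction_on with
  | _ M ihM =>
  -- normalised forms
  have key : ∀ a b c d e f : ℤ, a.toNat = N → (a * b - d ^ 2).toNat = M →
    0 < a → 0 < a * b - d ^ 2 →
    (a * b - d ^ 2) * (a * c - e ^ 2) - (a * f - d * e) ^ 2 = a →
    2 * d ≤ a → -a ≤ 2 * d → 2 * e ≤ a → -a ≤ 2 * e →
    2 * (a * f - d * e) ≤ a * b - d ^ 2 → -(a * b - d ^ 2) ≤ 2 * (a * f - d * e) →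
    ∀ x y z : ℤ, Sum3 (a * x ^ 2 + b * y ^ 2 + c * z ^ 2 + 2 * d * x * y + 2 * e * x * z + 2 * f * y * z) := by
    intro a b c d e f hN hM ha hg hdet hd1 hd2 he1 he2 hf1 hf2 x y z
    have hb : 0 < b := by
      by_contra hb
      push Not at hb
      nlinarith [mul_nonneg ha.le (neg_nonneg.2 hb), sq_nonneg d]
    by_cases hab : a ≤ b
    · by_cases hgg : a * b - d ^ 2 ≤ a * c - e ^ 2
      · obtain ⟨rfl, rfl, rfl, rfl, rfl, rfl⟩ :=
          reduced_case a b c d e f ha hg hdet hd1 hd2 he1 he2 hf1 hf2 hab hgg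
        exact ⟨x, y, z, by ring⟩
      · have hg2 : 0 < a * c - e ^ 2 := by
          by_contra h
          push Not at h
          nlinarith [mul_nonneg hg.le (neg_nonneg.2 h), sq_nonneg (a * f - d * e)]
        have := ihM (a * c - e ^ 2).toNat (by omega) a c b e d f hN rfl ha hg2 (by linarith) x z y
        convert this using 1
        ring
    · have hdet2 : (b * a - d ^ 2) * (b * c - f ^ 2) - (b * e - d * f) ^ 2 = b := by
        have : a * ((b * a - d ^ 2) * (b * c - f ^ 2) - (b * e - d * f) ^ 2) = a * b := by
          linear_combination b * hdet
        exact mul_left_cancel₀ ha.ne' this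
      have := ihN b.toNat (by omega) (b * a - d ^ 2).toNat b a c d f e rfl rfl hb (by linarith) hdet2 y x z
      convert this using 1
      ring
  intro a b c d e f hN hM ha hg hdet x y z
  -- normalise g12 by z-shift: y ↦ y + k z
  obtain ⟨k, hk1, hk2⟩ := exists_shift (a * b - d ^ 2) (a * f - d * e) hg
  obtain ⟨l, hl1, hl2⟩ := exists_shift a d ha
  obtain ⟨m, hm1, hm2⟩ := exists_shift a (e + k * d) ha
  -- substitute y = y' + k z, then x = x' + l y' + m z
  have := key a (b + 2 * l * d + l ^ 2 * a)
    (c + 2 * k * f + k ^ 2 * b + 2 * m * (e + k * d) + m ^ 2 * a)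
    (d + l * a) (e + k * d + m * a) (f + k * b + l * (e + k * d) + m * d + l * m * a) hN
    (by rw [← hM]; congr 1; ring) ha (by convert hg using 1; ring)
    (by linear_combination hdet) hl1 hl2 hm1 hm2
    (by convert hk1 using 1 <;> ring) (by convert hk2 using 1 <;> ring)
    (x - l * (y - k * z) - m * z) (y - k * z) z
  convert this using 1
  ring

lemma sum3_of_dvd (D n : ℤ) (b : ℤ) (hD : 0 < D) (hm : 0 < D * n - 1) (h : (D * n - 1) ∣ b ^ 2 + D) :
    Sum3 n := by
  obtain ⟨k, hk⟩ := h
  have := form_sum3 _ _ (D * n - 1) k n b 0 1 rfl rfl hm (by rw [← hk]; linarith)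
    (by rw [← hk]; ring) 0 0 1
  simpa using this

open scoped NumberTheorySymbols in
lemma sum3_two_mod_four (n : ℕ) (hn : n % 4 = 2) : Sum3 n := by
  obtain ⟨p, hp, hpp, hmod⟩ := Nat.forall_exists_prime_gt_and_modEq n (q := 4 * n) (a := n - 1)
    (by omega) (by
      apply Nat.Coprime.mul_right
      · rw [show 4 = 2 ^ 2 by norm_num]
        apply Nat.Coprime.pow_right
        rw [Nat.coprime_two_right, Nat.odd_iff]; omega
      · have := (Nat.coprime_self_sub_left (m := 1) (n := n) (by omega)).2 (by simp)
        simpa using this)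
  have hdvd := (Nat.modEq_iff_dvd' (by omega)).1 hmod.symm
  obtain ⟨j, hj⟩ := hdvd
  have hpe : p + 1 = (4 * j + 1) * n := by
    have : p = 4 * n * j + (n - 1) := by omega
    rw [this]
    have : n - 1 + 1 = n := by omega
    linear_combination this
  have hp4 : p % 4 = 1 := by
    have : (p + 1) % 4 = 2 := by rw [hpe, Nat.mul_mod, hn]; omega
    omega
  have : Fact p.Prime := ⟨hpp⟩
  have hJ : J(-((4 * j + 1 : ℕ) : ℤ) | p) = 1 := by
    rw [neg_eq_neg_one_mul, jacobiSym.mul_left, jacobiSym.at_neg_one (Nat.odd_iff.2 (by omega)),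
      ZMod.χ₄_nat_one_mod_four hp4, one_mul,
      jacobiSym.quadratic_reciprocity_one_mod_four (by omega) (Nat.odd_iff.2 (by omega)),
      jacobiSym.mod_left' (a₂ := -1), jacobiSym.at_neg_one (Nat.odd_iff.2 (by omega)),
      ZMod.χ₄_nat_one_mod_four (by omega)]
    apply Int.emod_emod_of_dvd _ (dvd_refl _) |>.symm.trans
    rw [Int.emod_emod_of_dvd _ (dvd_refl _)]
    apply Int.ModEq.symm
    rw [Int.modEq_iff_dvd]
    exact ⟨n, by push_cast; have : (p : ℤ) + 1 = (4 * j + 1) * n := by exact_mod_cast hpe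
                 linear_combination this⟩
  have hsq := ZMod.isSquare_of_jacobiSym_eq_one hJ
  obtain ⟨x, hx⟩ := hsq
  obtain ⟨b, rfl⟩ := ZMod.intCast_surjective x
  have hpe' : (p : ℤ) + 1 = (4 * j + 1) * n := by exact_mod_cast hpe
  apply sum3_of_dvd (4 * j + 1) n b (by positivity) (by have := hpp.pos; omega)
  rw [show ((4 * j + 1 : ℤ) * n - 1) = (p : ℤ) by linarith, ← ZMod.intCast_zmod_eq_zero_iff_dvd]
  push_cast at hx ⊢
  linear_combination -hx

open scoped NumberTheorySymbols in
lemma sum3_odd (n c : ℕ) (hn : n % 8 = 3 ∧ c = 1 ∨ n % 8 = 1 ∧ c = 3 ∨ n % 8 = 5 ∧ c = 3) :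
    Sum3 n := by
  have hh : ∃ h, 2 * h + 1 = c * n ∧ h % 2 = 1 ∧ (n % 8 = 5 → h % 4 = 3) ∧ (n % 8 ≠ 5 → h % 4 = 1) := by
    refine ⟨(c * n) / 2, ?_⟩
    rcases hn with ⟨h, rfl⟩ | ⟨h, rfl⟩ | ⟨h, rfl⟩ <;> omega
  obtain ⟨h, hh, hodd, h5, hn5⟩ := hh
  obtain ⟨p, hp, hpp, hmod⟩ := Nat.forall_exists_prime_gt_and_modEq h (q := 4 * n) (a := h)
    (by omega) (by
      apply Nat.Coprime.mul_right
      · rw [show 4 = 2 ^ 2 by norm_num]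
        apply Nat.Coprime.pow_right
        rw [Nat.coprime_two_right, Nat.odd_iff]; omega
      · rw [← Nat.isCoprime_iff_coprime]
        refine ⟨-2, c, ?_⟩
        have : 2 * (h : ℤ) + 1 = c * n := by exact_mod_cast hh
        linear_combination -this)
  have hdvd := (Nat.modEq_iff_dvd' (by omega)).1 hmod.symm
  obtain ⟨j, hj⟩ := hdvd
  have hpj : p = 4 * (n * j) + h := by rw [← mul_assoc]; omega
  have hpe : 2 * p + 1 = (8 * j + c) * n := by
    rw [hpj]
    linear_combination hh
  have : Fact p.Prime := ⟨hpp⟩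
  obtain ⟨D, hD⟩ : ∃ D, D = 8 * j + c := ⟨_, rfl⟩
  rw [← hD] at hpe
  have hpe' : 2 * (p : ℤ) + 1 = D * n := by exact_mod_cast hpe
  have hDodd : Odd D := Nat.odd_iff.2 (by omega)
  have hpodd : Odd p := Nat.odd_iff.2 (by omega)
  have e1 : J(2 | D) * J((p : ℤ) | D) = J(-1 | D) := by
    rw [← jacobiSym.mul_left]
    apply jacobiSym.mod_left'
    apply Int.ModEq.symm
    rw [Int.modEq_iff_dvd]
    exact ⟨n, by linear_combination hpe'⟩
  have e2 : J((p : ℤ) | D) = 1 := by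
    rw [jacobiSym.at_two hDodd, jacobiSym.at_neg_one hDodd, ZMod.χ₈_nat_eq_if_mod_eight,
      if_neg (by omega)] at e1
    by_cases h3 : n % 8 = 3
    · rw [if_pos (by omega), ZMod.χ₄_nat_one_mod_four (by omega)] at e1
      omega
    · rw [if_neg (by omega), ZMod.χ₄_nat_three_mod_four (by omega)] at e1
      omega
  have hJ : J(-(D : ℤ) | p) = 1 := by
    rw [neg_eq_neg_one_mul, jacobiSym.mul_left, jacobiSym.at_neg_one hpodd]
    by_cases h3 : n % 8 = 5
    · rw [ZMod.χ₄_nat_three_mod_four (by omega),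
        jacobiSym.quadratic_reciprocity_three_mod_four (by omega) (by omega), e2]
      norm_num
    · rw [ZMod.χ₄_nat_one_mod_four (by omega),
        jacobiSym.quadratic_reciprocity_one_mod_four' hDodd (by omega), e2]
      norm_num
  obtain ⟨x, hx⟩ := ZMod.isSquare_of_jacobiSym_eq_one hJ
  obtain ⟨b, rfl⟩ := ZMod.intCast_surjective x
  have hb : (p : ℤ) ∣ b ^ 2 + D := by
    rw [← ZMod.intCast_zmod_eq_zero_iff_dvd]
    push_cast at hx ⊢
    linear_combination -hx
  obtain ⟨b', hb', hodd'⟩ : ∃ b' : ℤ, (p : ℤ) ∣ b' ^ 2 + D ∧ Odd b' := by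
    rcases Int.even_or_odd b with he | ho
    · refine ⟨b + p, ?_, he.add_odd (by exact_mod_cast hpodd)⟩
      have : (b + p) ^ 2 + D = (b ^ 2 + D) + p * (2 * b + p) := by ring
      rw [this]
      exact dvd_add hb (dvd_mul_right _ _)
    · exact ⟨b, hb, ho⟩
  have h2 : (2 : ℤ) ∣ b' ^ 2 + D :=
    even_iff_two_dvd.1 (hodd'.pow.add_odd (by exact_mod_cast hDodd))
  have hcop : IsCoprime (2 : ℤ) p := by
    have := (Nat.coprime_two_left (n := p)).2 hpodd
    exact_mod_cast Nat.isCoprime_iff_coprime.2 this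
  apply sum3_of_dvd D n b' (by omega) (by have := hpp.pos; omega)
  rw [show (D : ℤ) * n - 1 = 2 * p by linarith]
  exact hcop.mul_dvd h2 hb'

lemma sum3_pow (a : ℕ) (m : ℤ) (h : Sum3 m) : Sum3 (4 ^ a * m) := by
  obtain ⟨x, y, z, h⟩ := h
  refine ⟨2 ^ a * x, 2 ^ a * y, 2 ^ a * z, ?_⟩
  rw [← h, show (4 : ℤ) = 2 ^ 2 by norm_num, ← pow_mul]
  ring

lemma sum3_of_not (m : ℕ) (h4 : m % 4 ≠ 0) (h7 : m % 8 ≠ 7) : Sum3 m := by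
  by_cases h2 : m % 4 = 2
  · exact sum3_two_mod_four m h2
  · by_cases h3 : m % 8 = 3
    · exact sum3_odd m 1 (by omega)
    · exact sum3_odd m 3 (by omega)

lemma not_sum3 (a : ℕ) : ∀ c : ℤ, ¬ Sum3 (4 ^ a * (8 * c + 7)) := by
  induction a with
  | zero =>
    rintro c ⟨x, y, z, h⟩
    have key : ∀ x : ℤ, ∃ k : ℤ, x ^ 2 = 8 * k ∨ x ^ 2 = 8 * k + 1 ∨ x ^ 2 = 8 * k + 4 := by
      intro x
      rcases Int.even_or_odd' x with ⟨k, rfl | rfl⟩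
      · rcases Int.even_or_odd' k with ⟨l, rfl | rfl⟩
        · exact ⟨2 * l ^ 2, Or.inl (by ring)⟩
        · exact ⟨2 * (l ^ 2 + l), Or.inr (Or.inr (by ring))⟩
      · obtain ⟨l, hl⟩ := Int.even_mul_succ_self k
        exact ⟨l, Or.inr (Or.inl (by linear_combination 4 * hl))⟩
    obtain ⟨k1, h1⟩ := key x
    obtain ⟨k2, h2⟩ := key y
    obtain ⟨k3, h3⟩ := key z
    omega
  | succ a ih =>
    rintro c ⟨x, y, z, h⟩
    rw [pow_succ (4 : ℤ) a] at h
    rcases Int.even_or_odd' x with ⟨k1, rfl | rfl⟩ <;>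
    rcases Int.even_or_odd' y with ⟨k2, rfl | rfl⟩ <;>
    rcases Int.even_or_odd' z with ⟨k3, rfl | rfl⟩
    · exact ih c ⟨k1, k2, k3, by linarith⟩
    all_goals (exfalso; ring_nf at h; generalize (4 : ℤ) ^ a * c = u at h; omega)

theorem stmt_0 (r : ℕ) (hr : 0 < r) (n : ℕ) (hn : 0 < n)
    (hloc : ∀ (p : ℕ) [Fact p.Prime],
      ∃ x y z t : ℤ_[p], x ^ 2 + y ^ 2 + z ^ 2 + 2 ^ (2 * r - 1) * t ^ 2 = (n : ℤ_[p])) :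
    ∃ x y z t : ℤ, x ^ 2 + y ^ 2 + z ^ 2 + 2 ^ (2 * r - 1) * t ^ 2 = (n : ℤ) := by
  obtain ⟨a, m, hm, hnm⟩ := Nat.exists_eq_pow_mul_and_not_dvd hn.ne' 4 (by norm_num)
  have hnm' : (n : ℤ) = 4 ^ a * m := by exact_mod_cast hnm
  by_cases h7 : m % 8 = 7
  · by_cases har : r ≤ a + 1
    · obtain ⟨k, rfl⟩ : ∃ k, a = (r - 1) + k := ⟨a - (r - 1), by omega⟩
      obtain ⟨s, rfl⟩ : ∃ s, r = s + 1 := ⟨r - 1, by omega⟩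
      have h := sum3_pow (s + k) _ (sum3_of_not (m - 2) (by omega) (by omega))
      obtain ⟨x, y, z, h⟩ := h
      refine ⟨x, y, z, 2 ^ k, ?_⟩
      rw [h, hnm', Nat.cast_sub (by omega), show 2 * (s + 1) - 1 = 2 * s + 1 by omega,
        show s + 1 - 1 = s by omega, show (4 : ℤ) = 2 ^ 2 by norm_num, ← pow_mul]
      push_cast
      ring
    · exfalso
      obtain ⟨x, y, z, t, h⟩ := hloc 2
      have h := congrArg (PadicInt.toZModPow (p := 2) (2 * a + 3)) h
      have h0 : (2 : ZMod (2 ^ (2 * a + 3))) ^ (2 * r - 1) = 0 := by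
        obtain ⟨s, hs⟩ : ∃ s, 2 * r - 1 = (2 * a + 3) + s := ⟨2 * r - 1 - (2 * a + 3), by omega⟩
        have : ((2 ^ (2 * a + 3) : ℕ) : ZMod (2 ^ (2 * a + 3))) = 0 := ZMod.natCast_self _
        rw [hs, pow_add 2 (2 * a + 3) s]
        push_cast at this
        rw [this, zero_mul]
      simp only [map_add, map_mul, map_pow, map_natCast, map_ofNat] at h
      rw [h0, zero_mul, add_zero] at h
      obtain ⟨X, hX⟩ := ZMod.intCast_surjective (PadicInt.toZModPow (p := 2) (2 * a + 3) x)
      obtain ⟨Y, hY⟩ := ZMod.intCast_surjective (PadicInt.toZModPow (p := 2) (2 * a + 3) y)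
      obtain ⟨Z, hZ⟩ := ZMod.intCast_surjective (PadicInt.toZModPow (p := 2) (2 * a + 3) z)
      rw [← hX, ← hY, ← hZ] at h
      have h' : ((X ^ 2 + Y ^ 2 + Z ^ 2 - n : ℤ) : ZMod (2 ^ (2 * a + 3))) = 0 := by
        push_cast
        rw [h, sub_self]
      rw [ZMod.intCast_zmod_eq_zero_iff_dvd] at h'
      obtain ⟨q, hq⟩ := h'
      have hm8 : (m : ℤ) = 8 * ((m / 8 : ℕ) : ℤ) + 7 := by omega
      apply not_sum3 a (((m / 8 : ℕ) : ℤ) + q)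
      refine ⟨X, Y, Z, ?_⟩
      have : ((2 ^ (2 * a + 3) : ℕ) : ℤ) = 4 ^ a * 8 := by
        push_cast
        rw [pow_add, pow_mul]; norm_num
      rw [this] at hq
      linear_combination hq + hnm' + 4 ^ a * hm8
  · obtain ⟨x, y, z, h⟩ := sum3_pow a _ (sum3_of_not m (by omega) h7)
    exact ⟨x, y, z, 0, by rw [h, hnm']; ring⟩
end

section
/- Let p be a prime, let L₁ be a ternary ℤ_p-lattice, e a nonnegative integer, ε a unit of ℤ_p, and suppose the scale of the last Jordan component of L₁ contains p^e ℤ_p. Then the quaternary ℤ_p-lattice L = L₁ ⊥ ⟨p^e ε⟩ represents every element of p^e ℤ_p. -/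
open Matrix

/-- `x` lies in the dual of the `ℤ_p`-lattice with Gram matrix `G` (w.r.t. the standard
basis of `ℚ_p³`): all products `B(x, z)` with integral `z` are `p`-adic integers. -/
def InDual (p : ℕ) [Fact p.Prime] (G : Matrix (Fin 3) (Fin 3) ℤ_[p])
    (x : Fin 3 → ℚ_[p]) : Prop :=
  ∀ z : Fin 3 → ℤ_[p],
    ‖x ⬝ᵥ (G.map ((↑) : ℤ_[p] → ℚ_[p])).mulVec (fun i => ((z i : ℚ_[p])))‖ ≤ 1

lemma hq {p : ℕ} [Fact p.Prime] (A B C a : ℤ_[p]) (h : (p : ℤ_[p]) ∣ A * a ^ 2 + B * a + C)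
    (hu : IsUnit (2 * A * a + B)) : ∃ z, A * z ^ 2 + B * z + C = 0 := by
  have := hensels_lemma (p := p) (R := ℤ_[p])
    (F := Polynomial.C A * Polynomial.X ^ 2 + Polynomial.C B * Polynomial.X + Polynomial.C C) (a := a) (by
      have h1 : ‖A * a ^ 2 + B * a + C‖ < 1 := (PadicInt.norm_lt_one_iff_dvd _).2 h
      have h2 : ‖2 * A * a + B‖ = 1 := PadicInt.isUnit_iff.1 hu
      have e1 : A * ((1 + 1) * a) + B = 2 * A * a + B := by ring
      simpa [e1, h2] using h1)
  obtain ⟨z, hz, -⟩ := this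
  exact ⟨z, by simpa using hz⟩

lemma isUnit_or {p : ℕ} [Fact p.Prime] (c : ℤ_[p]) : IsUnit c ∨ (p : ℤ_[p]) ∣ c := by
  by_cases h : (p : ℤ_[p]) ∣ c
  · exact Or.inr h
  · left
    rw [PadicInt.isUnit_iff]
    rw [← PadicInt.norm_lt_one_iff_dvd] at h
    exact le_antisymm (PadicInt.norm_le_one c) (not_lt.1 h)

lemma unit_ndvd {p : ℕ} [Fact p.Prime] {c : ℤ_[p]} (hc : IsUnit c) : ¬ (p : ℤ_[p]) ∣ c := by
  rw [← PadicInt.norm_lt_one_iff_dvd, PadicInt.isUnit_iff.1 hc]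
  simp

lemma unit_of_ndvd {p : ℕ} [Fact p.Prime] {c : ℤ_[p]} (hc : ¬ (p : ℤ_[p]) ∣ c) : IsUnit c :=
  (isUnit_or c).resolve_right hc

/-- recursion on squares of `p` -/
lemma sq_rec {p : ℕ} [Fact p.Prime] (S : ℤ_[p] → Prop) (h0 : S 0)
    (hs : ∀ c k, S c → S (k ^ 2 * c)) (h1 : ∀ c, IsUnit c → S c)
    (h2 : ∀ c, IsUnit c → S (p * c)) (c : ℤ_[p]) : S c := by
  by_cases hc : c = 0
  · rwa [hc]
  rw [PadicInt.unitCoeff_spec hc]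
  obtain ⟨k, hk | hk⟩ := Nat.even_or_odd' c.valuation
  · have := hs _ ((p : ℤ_[p]) ^ k) (h1 _ (PadicInt.unitCoeff hc).isUnit)
    rw [hk]
    convert this using 1
    ring
  · have := hs _ ((p : ℤ_[p]) ^ k) (h2 _ (PadicInt.unitCoeff hc).isUnit)
    rw [hk]
    convert this using 1
    ring

lemma two_unit {p : ℕ} [Fact p.Prime] (hp : p ≠ 2) : IsUnit (2 : ℤ_[p]) := by
  apply unit_of_ndvd
  intro h
  have h' : (p : ℤ_[p]) ∣ ((2 : ℕ) : ℤ_[p]) := by exact_mod_cast h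
  rw [← PadicInt.norm_lt_one_iff_dvd] at h'
  have h3 : (p : ℤ) ∣ 2 := by
    rw [← PadicInt.norm_int_lt_one_iff_dvd]
    exact_mod_cast h'
  have := (Nat.prime_dvd_prime_iff_eq (Fact.out : p.Prime) Nat.prime_two).1 (by exact_mod_cast h3)
  exact hp this

lemma toZMod_zero_iff {p : ℕ} [Fact p.Prime] (c : ℤ_[p]) :
    PadicInt.toZMod c = 0 ↔ (p : ℤ_[p]) ∣ c := by
  rw [← RingHom.mem_ker, PadicInt.ker_toZMod, PadicInt.maximalIdeal_eq_span_p,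
    Ideal.mem_span_singleton]

/-- odd `p`: binary unit forms represent units -/
lemma bin_unit {p : ℕ} [Fact p.Prime] (hp : p ≠ 2) (u v c : ℤ_[p]) (hu : IsUnit u) (hv : IsUnit v)
    (hc : IsUnit c) : ∃ x y, u * x ^ 2 + v * y ^ 2 = c := by
  have two := two_unit hp
  have hne : ∀ {w : ℤ_[p]}, IsUnit w → PadicInt.toZMod w ≠ 0 := fun hw h =>
    unit_ndvd hw ((toZMod_zero_iff _).1 h)
  obtain ⟨a, b, hab⟩ := FiniteField.exists_root_sum_quadratic (R := ZMod p)
    (f := Polynomial.C (PadicInt.toZMod u) * Polynomial.X ^ 2 + Polynomial.C 0 * Polynomial.X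
      + Polynomial.C (- PadicInt.toZMod c))
    (g := Polynomial.C (PadicInt.toZMod v) * Polynomial.X ^ 2 + Polynomial.C 0 * Polynomial.X
      + Polynomial.C 0)
    (Polynomial.degree_quadratic (hne hu)) (Polynomial.degree_quadratic (hne hv))
    (by
      rw [ZMod.card]
      exact ((Fact.out : p.Prime).eq_two_or_odd).resolve_left hp)
  obtain ⟨x, rfl⟩ := ZMod.ringHom_surjective (PadicInt.toZMod (p := p)) a
  obtain ⟨y, rfl⟩ := ZMod.ringHom_surjective (PadicInt.toZMod (p := p)) b
  have hd : (p : ℤ_[p]) ∣ u * x ^ 2 + v * y ^ 2 - c := by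
    rw [← toZMod_zero_iff]
    simp at hab ⊢
    linear_combination hab
  rcases isUnit_or x with hx | hx
  · obtain ⟨z, hz⟩ := hq u 0 (v * y ^ 2 - c) x (by convert hd using 1; ring)
      (by simpa using (two.mul hu).mul hx)
    exact ⟨z, y, by linear_combination hz⟩
  rcases isUnit_or y with hy | hy
  · obtain ⟨z, hz⟩ := hq v 0 (u * x ^ 2 - c) y (by convert hd using 1; ring)
      (by simpa using (two.mul hv).mul hy)
    exact ⟨x, z, by linear_combination hz⟩
  exfalso
  apply unit_ndvd hc
  obtain ⟨k, rfl⟩ := hx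
  obtain ⟨l, rfl⟩ := hy
  obtain ⟨m, hm⟩ := hd
  exact ⟨u * k ^ 2 * p + v * l ^ 2 * p - m, by linear_combination -hm⟩

lemma tern {p : ℕ} [Fact p.Prime] (hp : p ≠ 2) (u v w c : ℤ_[p]) (hu : IsUnit u) (hv : IsUnit v)
    (hw : IsUnit w) : ∃ x y z, u * x ^ 2 + v * y ^ 2 + w * z ^ 2 = c := by
  rcases isUnit_or c with hc | hc
  · obtain ⟨x, y, h⟩ := bin_unit hp u v c hu hv hc
    exact ⟨x, y, 0, by linear_combination h⟩
  · obtain ⟨x, y, h⟩ := bin_unit hp u v (c - w) hu hv (unit_of_ndvd fun h =>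
      unit_ndvd hw (by simpa using dvd_sub hc h))
    exact ⟨x, y, 1, by linear_combination h⟩

lemma quat112 {p : ℕ} [Fact p.Prime] (hp : p ≠ 2) (u v w ε c : ℤ_[p]) (hu : IsUnit u)
    (hv : IsUnit v) (hw : IsUnit w) (hε : IsUnit ε) :
    ∃ x y z t, u * x ^ 2 + v * y ^ 2 + p * w * z ^ 2 + p * ε * t ^ 2 = p * c := by
  apply sq_rec (p := p) (fun c => ∃ x y z t,
    u * x ^ 2 + v * y ^ 2 + p * w * z ^ 2 + p * ε * t ^ 2 = p * c)
  · exact ⟨0, 0, 0, 0, by ring⟩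
  · rintro c k ⟨x, y, z, t, h⟩
    exact ⟨k * x, k * y, k * z, k * t, by linear_combination k ^ 2 * h⟩
  · intro c hc
    obtain ⟨z, t, h⟩ := bin_unit hp w ε c hw hε hc
    exact ⟨0, 0, z, t, by linear_combination p * h⟩
  · intro c hc
    obtain ⟨z, t, h⟩ := bin_unit hp u v c hu hv hc
    exact ⟨p * z, p * t, 0, 0, by linear_combination p ^ 2 * h⟩

lemma core_odd {p : ℕ} [Fact p.Prime] (hp : p ≠ 2) (u v w ε c d₁ d₂ d₃ : ℤ_[p]) (hu : IsUnit u)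
    (hv : IsUnit v) (hw : IsUnit w) (hε : IsUnit ε) (h₁ : d₁ = u ∨ d₁ = p * u)
    (h₂ : d₂ = v ∨ d₂ = p * v) (h₃ : d₃ = w ∨ d₃ = p * w) :
    ∃ x y z t, d₁ * x ^ 2 + d₂ * y ^ 2 + d₃ * z ^ 2 + p * ε * t ^ 2 = p * c := by
  rcases h₁ with rfl | rfl <;> rcases h₂ with rfl | rfl <;> rcases h₃ with rfl | rfl
  · obtain ⟨x, y, z, h⟩ := tern hp d₁ d₂ d₃ (p * c) hu hv hw
    exact ⟨x, y, z, 0, by linear_combination h⟩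
  · obtain ⟨x, y, z, t, h⟩ := quat112 hp d₁ d₂ w ε c hu hv hw hε
    exact ⟨x, y, z, t, by linear_combination h⟩
  · obtain ⟨x, y, z, t, h⟩ := quat112 hp d₁ d₃ v ε c hu hw hv hε
    exact ⟨x, z, y, t, by linear_combination h⟩
  · obtain ⟨x, y, z, h⟩ := tern hp v w ε c hv hw hε
    exact ⟨0, x, y, z, by linear_combination p * h⟩
  · obtain ⟨x, y, z, t, h⟩ := quat112 hp d₂ d₃ u ε c hv hw hu hε
    exact ⟨z, x, y, t, by linear_combination h⟩
  · obtain ⟨x, y, z, h⟩ := tern hp u w ε c hu hw hε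
    exact ⟨x, 0, y, z, by linear_combination p * h⟩
  · obtain ⟨x, y, z, h⟩ := tern hp u v ε c hu hv hε
    exact ⟨x, y, 0, z, by linear_combination p * h⟩
  · obtain ⟨x, y, z, h⟩ := tern hp u v ε c hu hv hε
    exact ⟨x, y, 0, z, by linear_combination p * h⟩

lemma sq8 (w : ℤ_[2]) : ∃ X, X ^ 2 = 1 + 8 * w := by
  obtain ⟨z, hz⟩ := hq (p := 2) 1 1 (-(2 * w)) 0 ⟨-w, by push_cast; ring⟩ (by simp)
  exact ⟨1 + 2 * z, by linear_combination 4 * hz⟩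

lemma lift8 {u R c : ℤ_[2]} (hu : IsUnit u) (h : (8 : ℤ_[2]) ∣ u + R - c) :
    ∃ X, u * X ^ 2 + R = c := by
  obtain ⟨k, hk⟩ := h
  obtain ⟨v, rfl⟩ := hu
  obtain ⟨X, hX⟩ := sq8 (-k * (v⁻¹ : ℤ_[2]ˣ))
  refine ⟨X, ?_⟩
  have := v.mul_inv
  rw [hX]
  linear_combination hk - 8 * k * this

lemma lift16 {u R c : ℤ_[2]} (hu : IsUnit u) (h : (16 : ℤ_[2]) ∣ 2 * u + R - c) :
    ∃ X, 2 * u * X ^ 2 + R = c := by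
  obtain ⟨k, hk⟩ := h
  obtain ⟨v, rfl⟩ := hu
  obtain ⟨X, hX⟩ := sq8 (-k * (v⁻¹ : ℤ_[2]ˣ))
  refine ⟨X, ?_⟩
  have := v.mul_inv
  linear_combination hk - 16 * k * this + 2 * v * hX

def cf (D : Bool) (a : ℕ) : ℕ := bif D then 2 * a else a

def vs : List ℕ := [0, 1, 2]

def okb (D₁ D₂ D₃ : Bool) (a b c r x y z t : ℕ) : Bool :=
  bif Nat.beq t 1 || (!D₁ && Nat.beq x 1) || (!D₂ && Nat.beq y 1) || (!D₃ && Nat.beq z 1) then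
    Nat.beq ((cf D₁ a * (x * x) + cf D₂ b * (y * y) + cf D₃ c * (z * z) + t * t) % 8) (r % 8)
  else (Nat.beq x 1 || Nat.beq y 1 || Nat.beq z 1) &&
    Nat.beq ((cf D₁ a * (x * x) + cf D₂ b * (y * y) + cf D₃ c * (z * z) + t * t) % 16) (r % 16)

def okl (D₁ D₂ D₃ : Bool) (a b c r : ℕ) : Bool :=
  vs.any fun x => vs.any fun y => vs.any fun z => vs.any fun t => okb D₁ D₂ D₃ a b c r x y z t

def us : List ℕ := [1, 3, 5, 7]

def okall (D₁ D₂ D₃ : Bool) : Bool :=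
  us.all fun a => us.all fun b => us.all fun c =>
    [1, 3, 5, 7, 9, 11, 13, 15, 2, 6, 10, 14].all fun r => okl D₁ D₂ D₃ a b c r

lemma okall_true : (okall false false false && okall false false true && okall false true true
  && okall true true true) = true := by
  decide +kernel

lemma res8 {u : ℤ_[2]} (hu : IsUnit u) : ∃ a ∈ us, (8 : ℤ_[2]) ∣ u - (a : ℕ) := by
  have h1 := PadicInt.appr_spec 3 u
  have h2 := PadicInt.appr_lt u 3
  set n := u.appr 3
  rw [Ideal.mem_span_singleton] at h1
  have h3 : ((2 : ℕ) : ℤ_[2]) ^ 3 = 8 := by norm_num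
  rw [h3] at h1
  have h4 := unit_ndvd hu
  obtain ⟨k, hk⟩ := h1
  refine ⟨n, ?_, ⟨k, hk⟩⟩
  have ho : ¬ 2 ∣ n := by
    rintro ⟨m, hm⟩
    apply h4
    refine ⟨m + 4 * k, ?_⟩
    rw [hm] at hk
    push_cast at hk ⊢
    linear_combination hk
  clear_value n
  simp only [us]
  interval_cases n <;> simp_all

lemma res16 {u : ℤ_[2]} (hu : IsUnit u) :
    ∃ a ∈ [1, 3, 5, 7, 9, 11, 13, 15], (16 : ℤ_[2]) ∣ u - (a : ℕ) := by
  have h1 := PadicInt.appr_spec 4 u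
  have h2 := PadicInt.appr_lt u 4
  set n := u.appr 4
  rw [Ideal.mem_span_singleton] at h1
  have h3 : ((2 : ℕ) : ℤ_[2]) ^ 4 = 16 := by norm_num
  rw [h3] at h1
  have h4 := unit_ndvd hu
  obtain ⟨k, hk⟩ := h1
  refine ⟨n, ?_, ⟨k, hk⟩⟩
  have ho : ¬ 2 ∣ n := by
    rintro ⟨m, hm⟩
    apply h4
    refine ⟨m + 8 * k, ?_⟩
    rw [hm] at hk
    push_cast at hk ⊢
    linear_combination hk
  clear_value n
  interval_cases n <;> simp_all

noncomputable def cz (D : Bool) (u : ℤ_[2]) : ℤ_[2] := bif D then 2 * u else u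

lemma dvd_nat {m a b : ℕ} (h : a % m = b % m) : (m : ℤ_[2]) ∣ (a : ℤ_[2]) - b := by
  have : (m : ℤ) ∣ (a : ℤ) - b := by
    apply Int.ModEq.dvd
    exact (Int.natCast_modEq_iff.2 h).symm
  have := (Int.castRingHom ℤ_[2]).map_dvd this
  simpa using this

lemma cz_cf8 {D : Bool} {u : ℤ_[2]} {a : ℕ} (h : (8 : ℤ_[2]) ∣ u - a) :
    (8 : ℤ_[2]) ∣ cz D u - cf D a := by
  obtain ⟨k, hk⟩ := h
  cases D
  · exact ⟨k, by simpa [cz, cf] using hk⟩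
  · exact ⟨2 * k, by simp [cz, cf]; linear_combination 2 * hk⟩

lemma sound8 {D₁ D₂ D₃ : Bool} {u v w c : ℤ_[2]} {a b e r x y z t : ℕ}
    (hu : (8 : ℤ_[2]) ∣ u - a) (hv : (8 : ℤ_[2]) ∣ v - b) (hw : (8 : ℤ_[2]) ∣ w - e)
    (hc : (16 : ℤ_[2]) ∣ c - r)
    (h : (cf D₁ a * (x * x) + cf D₂ b * (y * y) + cf D₃ e * (z * z) + t * t) % 8 = r % 8) :
    (8 : ℤ_[2]) ∣ cz D₁ u * x ^ 2 + cz D₂ v * y ^ 2 + cz D₃ w * z ^ 2 + t ^ 2 - c := by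
  have h' := dvd_nat h
  push_cast at h'
  obtain ⟨k1, h1⟩ := cz_cf8 (D := D₁) hu
  obtain ⟨k2, h2⟩ := cz_cf8 (D := D₂) hv
  obtain ⟨k3, h3⟩ := cz_cf8 (D := D₃) hw
  obtain ⟨k4, h4⟩ := hc
  obtain ⟨k5, h5⟩ := h'
  exact ⟨k1 * x ^ 2 + k2 * y ^ 2 + k3 * z ^ 2 - 2 * k4 + k5, by
    linear_combination x ^ 2 * h1 + y ^ 2 * h2 + z ^ 2 * h3 - h4 + h5⟩

lemma cz_cf16 {D : Bool} {u : ℤ_[2]} {a x : ℕ} (hx : x ∈ vs) (hD : ¬ (D = false ∧ x = 1))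
    (h : (8 : ℤ_[2]) ∣ u - a) :
    (16 : ℤ_[2]) ∣ (cz D u - cf D a) * x ^ 2 := by
  obtain ⟨k, hk⟩ := h
  cases D
  · simp only [vs, List.mem_cons, List.not_mem_nil, or_false] at hx
    rcases hx with rfl | rfl | rfl
    · simp
    · simp at hD
    · exact ⟨2 * k, by simp [cz, cf]; linear_combination 4 * hk⟩
  · exact ⟨k * x ^ 2, by simp [cz, cf]; linear_combination 2 * x ^ 2 * hk⟩

lemma sound16 {D₁ D₂ D₃ : Bool} {u v w c : ℤ_[2]} {a b e r x y z t : ℕ}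
    (hx : x ∈ vs) (hy : y ∈ vs) (hz : z ∈ vs)
    (hDx : ¬ (D₁ = false ∧ x = 1)) (hDy : ¬ (D₂ = false ∧ y = 1)) (hDz : ¬ (D₃ = false ∧ z = 1))
    (hu : (8 : ℤ_[2]) ∣ u - a) (hv : (8 : ℤ_[2]) ∣ v - b) (hw : (8 : ℤ_[2]) ∣ w - e)
    (hc : (16 : ℤ_[2]) ∣ c - r)
    (h : (cf D₁ a * (x * x) + cf D₂ b * (y * y) + cf D₃ e * (z * z) + t * t) % 16 = r % 16) :
    (16 : ℤ_[2]) ∣ cz D₁ u * x ^ 2 + cz D₂ v * y ^ 2 + cz D₃ w * z ^ 2 + t ^ 2 - c := by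
  have h' := dvd_nat h
  push_cast at h'
  obtain ⟨k1, h1⟩ := cz_cf16 hx hDx hu
  obtain ⟨k2, h2⟩ := cz_cf16 hy hDy hv
  obtain ⟨k3, h3⟩ := cz_cf16 hz hDz hw
  obtain ⟨k4, h4⟩ := hc
  obtain ⟨k5, h5⟩ := h'
  exact ⟨k1 + k2 + k3 - k4 + k5, by
    linear_combination h1 + h2 + h3 - h4 + h5⟩

lemma lift_t {R c : ℤ_[2]} {t : ℕ} (ht : t = 1) (h : (8 : ℤ_[2]) ∣ R + t ^ 2 - c) :
    ∃ T, R + T ^ 2 = c := by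
  subst ht
  obtain ⟨X, hX⟩ := lift8 (u := 1) (R := R) (c := c) isUnit_one (by
    convert h using 1; push_cast; ring)
  exact ⟨X, by linear_combination hX⟩

lemma lift_x8 {R u c : ℤ_[2]} {D : Bool} {x : ℕ} (hu : IsUnit u) (hx : D = false ∧ x = 1)
    (h : (8 : ℤ_[2]) ∣ cz D u * x ^ 2 + R - c) : ∃ T, cz D u * T ^ 2 + R = c := by
  obtain ⟨rfl, rfl⟩ := hx
  simp only [cz, cond_false] at *
  exact lift8 hu (by simpa using h)

lemma lift_x16 {R u c : ℤ_[2]} {D : Bool} {x : ℕ} (hu : IsUnit u) (hx : x = 1)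
    (hD : ¬ (D = false ∧ x = 1))
    (h : (16 : ℤ_[2]) ∣ cz D u * x ^ 2 + R - c) : ∃ T, cz D u * T ^ 2 + R = c := by
  subst hx
  have : D = true := by simpa using hD
  subst this
  simp only [cz, cond_true] at *
  exact lift16 hu (by simpa using h)

lemma okl_sound {D₁ D₂ D₃ : Bool} {u v w c : ℤ_[2]} {a b e r : ℕ}
    (hu' : IsUnit u) (hv' : IsUnit v) (hw' : IsUnit w)
    (hu : (8 : ℤ_[2]) ∣ u - a) (hv : (8 : ℤ_[2]) ∣ v - b) (hw : (8 : ℤ_[2]) ∣ w - e)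
    (hc : (16 : ℤ_[2]) ∣ c - r) (h : okl D₁ D₂ D₃ a b e r = true) :
    ∃ x y z t, cz D₁ u * x ^ 2 + cz D₂ v * y ^ 2 + cz D₃ w * z ^ 2 + t ^ 2 = c := by
  simp only [okl, List.any_eq_true] at h
  obtain ⟨x, hx, y, hy, z, hz, t, ht, h⟩ := h
  by_cases hh : t = 1 ∨ (D₁ = false ∧ x = 1) ∨ (D₂ = false ∧ y = 1) ∨ (D₃ = false ∧ z = 1)
  · have h8 : (cf D₁ a * (x * x) + cf D₂ b * (y * y) + cf D₃ e * (z * z) + t * t) % 8 = r % 8 := by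
      have hb : (Nat.beq t 1 || (!D₁ && Nat.beq x 1) || (!D₂ && Nat.beq y 1)
          || (!D₃ && Nat.beq z 1)) = true := by
        simp only [Bool.or_eq_true, Bool.and_eq_true, Nat.beq_eq, Bool.not_eq_true']
        tauto
      rw [okb, hb, cond_true, Nat.beq_eq] at h
      exact h
    have H := sound8 hu hv hw hc h8
    rcases hh with ht | hh | hh | hh
    · obtain ⟨T, hT⟩ := lift_t ht H
      exact ⟨x, y, z, T, hT⟩
    · obtain ⟨T, hT⟩ := lift_x8 (R := cz D₂ v * y ^ 2 + cz D₃ w * z ^ 2 + t ^ 2) (c := c) hu' hh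
        (by convert H using 1; ring)
      exact ⟨T, y, z, t, by linear_combination hT⟩
    · obtain ⟨T, hT⟩ := lift_x8 (R := cz D₁ u * x ^ 2 + cz D₃ w * z ^ 2 + t ^ 2) (c := c) hv' hh
        (by convert H using 1; ring)
      exact ⟨x, T, z, t, by linear_combination hT⟩
    · obtain ⟨T, hT⟩ := lift_x8 (R := cz D₁ u * x ^ 2 + cz D₂ v * y ^ 2 + t ^ 2) (c := c) hw' hh
        (by convert H using 1; ring)
      exact ⟨x, y, T, t, by linear_combination hT⟩
  · have hb : (Nat.beq t 1 || (!D₁ && Nat.beq x 1) || (!D₂ && Nat.beq y 1)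
          || (!D₃ && Nat.beq z 1)) = false := by
      rw [← Bool.not_eq_true]
      simp only [Bool.or_eq_true, Bool.and_eq_true, Nat.beq_eq, Bool.not_eq_true']
      tauto
    rw [okb, hb, cond_false] at h
    simp only [Bool.or_eq_true, Bool.and_eq_true, Nat.beq_eq] at h
    push Not at hh
    obtain ⟨-, hDx, hDy, hDz⟩ := hh
    have hDx : ¬ (D₁ = false ∧ x = 1) := fun hh => hDx hh.1 hh.2
    have hDy : ¬ (D₂ = false ∧ y = 1) := fun hh => hDy hh.1 hh.2
    have hDz : ¬ (D₃ = false ∧ z = 1) := fun hh => hDz hh.1 hh.2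
    have H := sound16 hx hy hz hDx hDy hDz hu hv hw hc h.2
    rcases h.1 with (hh | hh) | hh
    · obtain ⟨T, hT⟩ := lift_x16 (R := cz D₂ v * y ^ 2 + cz D₃ w * z ^ 2 + t ^ 2) (c := c) hu' hh hDx
        (by convert H using 1; ring)
      exact ⟨T, y, z, t, by linear_combination hT⟩
    · obtain ⟨T, hT⟩ := lift_x16 (R := cz D₁ u * x ^ 2 + cz D₃ w * z ^ 2 + t ^ 2) (c := c) hv' hh hDy
        (by convert H using 1; ring)
      exact ⟨x, T, z, t, by linear_combination hT⟩
    · obtain ⟨T, hT⟩ := lift_x16 (R := cz D₁ u * x ^ 2 + cz D₂ v * y ^ 2 + t ^ 2) (c := c) hw' hh hDz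
        (by convert H using 1; ring)
      exact ⟨x, y, T, t, by linear_combination hT⟩

lemma two_one {D₁ D₂ D₃ : Bool} (hD : okall D₁ D₂ D₃ = true) {u v w : ℤ_[2]}
    (hu : IsUnit u) (hv : IsUnit v) (hw : IsUnit w) (c : ℤ_[2]) :
    ∃ x y z t, cz D₁ u * x ^ 2 + cz D₂ v * y ^ 2 + cz D₃ w * z ^ 2 + t ^ 2 = c := by
  obtain ⟨a, ha, ha'⟩ := res8 hu
  obtain ⟨b, hb, hb'⟩ := res8 hv
  obtain ⟨e, he, he'⟩ := res8 hw
  simp only [okall, List.all_eq_true] at hD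
  have hD := hD a ha b hb e he
  apply sq_rec (p := 2) (fun c => ∃ x y z t,
    cz D₁ u * x ^ 2 + cz D₂ v * y ^ 2 + cz D₃ w * z ^ 2 + t ^ 2 = c)
  · exact ⟨0, 0, 0, 0, by ring⟩
  · rintro c k ⟨x, y, z, t, h⟩
    exact ⟨k * x, k * y, k * z, k * t, by linear_combination k ^ 2 * h⟩
  · intro c hc
    obtain ⟨r, hr, hr'⟩ := res16 hc
    exact okl_sound hu hv hw ha' hb' he' hr' (hD r (by
      simp only [List.mem_cons, List.not_mem_nil, or_false] at hr ⊢; tauto))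
  · intro c hc
    obtain ⟨r, hr, k, hk⟩ := res8 hc
    refine okl_sound (r := 2 * r) hu hv hw ha' hb' he' ⟨k, ?_⟩ (hD _ ?_)
    · push_cast; linear_combination 2 * hk
    · simp only [us, List.mem_cons, List.not_mem_nil, or_false] at hr
      rcases hr with rfl | rfl | rfl | rfl <;> simp

lemma two_any (D₁ D₂ D₃ : Bool) {u v w : ℤ_[2]}
    (hu : IsUnit u) (hv : IsUnit v) (hw : IsUnit w) (c : ℤ_[2]) :
    ∃ x y z t, cz D₁ u * x ^ 2 + cz D₂ v * y ^ 2 + cz D₃ w * z ^ 2 + t ^ 2 = c := by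
  have H := okall_true
  simp only [Bool.and_eq_true] at H
  obtain ⟨⟨⟨h0, h1⟩, h2⟩, h3⟩ := H
  cases D₁ <;> cases D₂ <;> cases D₃
  · exact two_one h0 hu hv hw c
  · exact two_one h1 hu hv hw c
  · obtain ⟨x, y, z, t, h⟩ := two_one h1 hu hw hv c
    exact ⟨x, z, y, t, by linear_combination h⟩
  · exact two_one h2 hu hv hw c
  · obtain ⟨x, y, z, t, h⟩ := two_one h1 hv hw hu c
    exact ⟨z, x, y, t, by linear_combination h⟩
  · obtain ⟨x, y, z, t, h⟩ := two_one h2 hv hu hw c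
    exact ⟨y, x, z, t, by linear_combination h⟩
  · obtain ⟨x, y, z, t, h⟩ := two_one h2 hw hu hv c
    exact ⟨y, z, x, t, by linear_combination h⟩
  · exact two_one h3 hu hv hw c

lemma halve {u d : ℤ_[2]} (h : d = u ∨ d = (2 : ℕ) * u) :
    ∃ (D : Bool) (k : ℤ_[2]), d * k ^ 2 = 2 * cz D u := by
  rcases h with rfl | rfl
  · exact ⟨true, 2, by simp [cz]; ring⟩
  · exact ⟨false, 1, by simp [cz]⟩

lemma cz_mul (D : Bool) (a u : ℤ_[2]) : cz D (a * u) = a * cz D u := by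
  cases D <;> simp [cz]
  ring

lemma core_two (u v w ε c d₁ d₂ d₃ : ℤ_[2]) (hu : IsUnit u)
    (hv : IsUnit v) (hw : IsUnit w) (hε : IsUnit ε) (h₁ : d₁ = u ∨ d₁ = (2 : ℕ) * u)
    (h₂ : d₂ = v ∨ d₂ = (2 : ℕ) * v) (h₃ : d₃ = w ∨ d₃ = (2 : ℕ) * w) :
    ∃ x y z t, d₁ * x ^ 2 + d₂ * y ^ 2 + d₃ * z ^ 2 + (2 : ℕ) * ε * t ^ 2 = (2 : ℕ) * c := by
  obtain ⟨D₁, k₁, e₁⟩ := halve h₁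
  obtain ⟨D₂, k₂, e₂⟩ := halve h₂
  obtain ⟨D₃, k₃, e₃⟩ := halve h₃
  obtain ⟨ε, rfl⟩ := hε
  have hi : IsUnit ((ε⁻¹ : ℤ_[2]ˣ) : ℤ_[2]) := Units.isUnit _
  obtain ⟨x, y, z, t, h⟩ := two_any D₁ D₂ D₃ (hi.mul hu) (hi.mul hv) (hi.mul hw)
    (((ε⁻¹ : ℤ_[2]ˣ) : ℤ_[2]) * c)
  refine ⟨k₁ * x, k₂ * y, k₃ * z, t, ?_⟩
  simp only [cz_mul] at h
  have hm := ε.mul_inv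
  push_cast
  linear_combination x ^ 2 * e₁ + y ^ 2 * e₂ + z ^ 2 * e₃ + 2 * ε * h - (2 * (cz D₁ u * x ^ 2
    + cz D₂ v * y ^ 2 + cz D₃ w * z ^ 2 - c)) * hm

lemma even_unit (s u t c : ℤ_[2]) (hu : IsUnit u) (hc : IsUnit c) :
    ∃ x y, s * x ^ 2 + u * x * y + t * y ^ 2 = c := by
  have odd2 : ∀ {a b : ℤ_[2]}, IsUnit a → IsUnit b → ((2 : ℕ) : ℤ_[2]) ∣ a - b := by
    intro a b ha hb
    obtain ⟨m, hm, k, hk⟩ := res8 ha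
    obtain ⟨n, hn, l, hl⟩ := res8 hb
    have : m % 2 = n % 2 := by
      simp only [us, List.mem_cons, List.not_mem_nil, or_false] at hm hn
      omega
    obtain ⟨q, hq⟩ := dvd_nat this
    push_cast at hq ⊢
    exact ⟨4 * k - 4 * l + q, by linear_combination hk - hl + hq⟩
  rcases isUnit_or s with hs | hs
  · obtain ⟨z, hz⟩ := hq t u (s - c) 0 (by simpa using odd2 hs hc) (by simpa using hu)
    exact ⟨1, z, by linear_combination hz⟩
  rcases isUnit_or t with ht | ht
  · obtain ⟨z, hz⟩ := hq s u (t - c) 0 (by simpa using odd2 ht hc) (by simpa using hu)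
    exact ⟨z, 1, by linear_combination hz⟩
  · obtain ⟨z, hz⟩ := hq t u (s - c) 1 (by
        convert dvd_add (dvd_add hs ht) (odd2 hu hc) using 1; ring) (by
        apply unit_of_ndvd
        intro h
        apply unit_ndvd hu
        have : ((2 : ℕ) : ℤ_[2]) ∣ 2 * t * 1 := ⟨t, by push_cast; ring⟩
        simpa using dvd_sub h this)
    exact ⟨1, z, by linear_combination hz⟩

lemma odd_sub {a b : ℤ_[2]} (ha : IsUnit a) (hb : IsUnit b) : ∃ k, a - b = 2 * k := by
  obtain ⟨m, hm, k, hk⟩ := res8 ha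
  obtain ⟨n, hn, l, hl⟩ := res8 hb
  have : m % 2 = n % 2 := by
    simp only [us, List.mem_cons, List.not_mem_nil, or_false] at hm hn
    omega
  obtain ⟨q, hq⟩ := dvd_nat this
  push_cast at hq
  exact ⟨4 * k - 4 * l + q, by linear_combination hk - hl + hq⟩

lemma core_even (s u t w ε c d f : ℤ_[2]) (hu : IsUnit u) (hw : IsUnit w) (hε : IsUnit ε)
    (hf : f = 1 ∨ f = (2 : ℕ)) (hd : d = w ∨ d = (2 : ℕ) * w) :
    ∃ x y z r, f * (2 * (s * x ^ 2 + u * x * y + t * y ^ 2)) + d * z ^ 2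
      + (2 : ℕ) * ε * r ^ 2 = (2 : ℕ) * c := by
  have key : ∀ a : ℤ_[2], ∃ δ : ℤ_[2], (δ = 0 ∨ δ = 1) ∧ IsUnit (a - δ * w) := by
    intro a
    rcases isUnit_or a with ha | ha
    · exact ⟨0, Or.inl rfl, by simpa using ha⟩
    · refine ⟨1, Or.inr rfl, unit_of_ndvd fun h => unit_ndvd hw ?_⟩
      simpa using dvd_sub ha h
  rcases hf with rfl | rfl
  · rcases isUnit_or c with hc | hc
    · obtain ⟨x, y, h⟩ := even_unit s u t c hu hc
      exact ⟨x, y, 0, 0, by push_cast; linear_combination 2 * h⟩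
    · obtain ⟨x, y, h⟩ := even_unit s u t (c - ε) hu (unit_of_ndvd fun h => unit_ndvd hε
        (by simpa using dvd_sub hc h))
      exact ⟨x, y, 0, 1, by push_cast; linear_combination 2 * h⟩
  rcases hd with rfl | rfl
  · have : ∃ r a : ℤ_[2], c - ε * r ^ 2 = 2 * a := by
      rcases isUnit_or c with hc | ⟨a, ha⟩
      · obtain ⟨k, hk⟩ := odd_sub hc hε
        exact ⟨1, k, by linear_combination hk⟩
      · exact ⟨0, a, by push_cast at ha; linear_combination ha⟩
    obtain ⟨r, a, ha⟩ := this
    obtain ⟨δ, hδ, hun⟩ := key a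
    obtain ⟨x, y, h⟩ := even_unit s u t _ hu hun
    refine ⟨x, y, 2 * δ, r, ?_⟩
    have : δ ^ 2 = δ := by rcases hδ with rfl | rfl <;> ring
    push_cast
    linear_combination 4 * h - 2 * ha + 4 * d * this
  · apply sq_rec (p := 2) (fun c => ∃ x y z r,
      (2 : ℕ) * (2 * (s * x ^ 2 + u * x * y + t * y ^ 2)) + (2 : ℕ) * w * z ^ 2
      + (2 : ℕ) * ε * r ^ 2 = (2 : ℕ) * c)
    · exact ⟨0, 0, 0, 0, by ring⟩
    · rintro c k ⟨x, y, z, t, h⟩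
      exact ⟨k * x, k * y, k * z, k * t, by linear_combination k ^ 2 * h⟩
    · intro c hc
      obtain ⟨k, hk⟩ := odd_sub hc hw
      rcases isUnit_or k with hku | ⟨l, hl⟩
      · obtain ⟨x, y, h⟩ := even_unit s u t k hu hku
        exact ⟨x, y, 1, 0, by push_cast; linear_combination 4 * h - 2 * hk⟩
      · push_cast at hl
        rcases isUnit_or l with hlu | ⟨m, hm⟩
        · obtain ⟨j, hj⟩ := odd_sub hlu hε
          obtain ⟨X, hX⟩ := lift8 (u := w) (R := 4 * ε) (c := c) hw ⟨-j, by
            linear_combination - hk - 2 * hl - 4 * hj⟩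
          exact ⟨0, 0, X, 2, by push_cast; linear_combination 2 * hX⟩
        · push_cast at hm
          obtain ⟨X, hX⟩ := lift8 (u := w) (R := 0) (c := c) hw ⟨-m, by
            linear_combination - hk - 2 * hl - 4 * hm⟩
          exact ⟨0, 0, X, 0, by push_cast; linear_combination 2 * hX⟩
    · intro c hc
      obtain ⟨x, y, h⟩ := even_unit s u t c hu hc
      exact ⟨x, y, 0, 0, by push_cast; linear_combination 4 * h⟩

section geom

variable {p : ℕ} [Fact p.Prime]

abbrev V3 (p : ℕ) [Fact p.Prime] := Fin 3 → ℤ_[p]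

/-- The lattice condition: `N` has all Jordan scales containing `p^e`. -/
def Good (e : ℕ) (B : LinearMap.BilinForm ℤ_[p] (V3 p)) (N : Submodule ℤ_[p] (V3 p)) : Prop :=
  ∀ x ∈ N, (∀ y ∈ N, (p : ℤ_[p]) ^ (e + 1) ∣ B x y) → ∃ x' ∈ N, x = (p : ℤ_[p]) • x'

lemma p_ne : (p : ℤ_[p]) ≠ 0 := by
  exact_mod_cast (Fact.out : p.Prime).ne_zero

lemma unit_of_pow {a : ℕ} {z : ℤ_[p]} (h : (p : ℤ_[p]) ^ a ∣ z) (h' : ¬ (p : ℤ_[p]) ^ (a + 1) ∣ z) :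
    ∃ u, IsUnit u ∧ z = (p : ℤ_[p]) ^ a * u := by
  obtain ⟨u, rfl⟩ := h
  refine ⟨u, unit_of_ndvd fun hu => h' ?_, rfl⟩
  rw [pow_succ]
  exact mul_dvd_mul_left _ hu

lemma step {e : ℕ} {B : LinearMap.BilinForm ℤ_[p] (V3 p)} {N : Submodule ℤ_[p] (V3 p)}
    (hN : N ≠ ⊥) (hG : Good e B N) :
    ∃ a ≤ e, (∀ x ∈ N, ∀ y ∈ N, (p : ℤ_[p]) ^ a ∣ B x y) ∧
      ∃ x ∈ N, ∃ y ∈ N, ∃ u, IsUnit u ∧ B x y = (p : ℤ_[p]) ^ a * u := by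
  classical
  have hex : ∃ a, ∃ x ∈ N, ∃ y ∈ N, ¬ (p : ℤ_[p]) ^ (a + 1) ∣ B x y := by
    by_contra hcon
    push Not at hcon
    apply hN
    refine Submodule.eq_bot_of_le_smul_of_le_jacobson_bot (Ideal.span {(p : ℤ_[p])}) N
      (IsNoetherian.noetherian N) ?_ ?_
    · intro x hx
      obtain ⟨x', hx', rfl⟩ := hG x hx (fun y hy => hcon e x hx y hy)
      exact Submodule.smul_mem_smul (Ideal.mem_span_singleton_self _) hx'
    · rw [← PadicInt.maximalIdeal_eq_span_p]
      exact (IsLocalRing.jacobson_eq_maximalIdeal ⊥ bot_ne_top).ge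
  have hle : Nat.find hex ≤ e := by
    by_contra hlt
    push Not at hlt
    have hcon := Nat.find_min hex hlt
    push Not at hcon
    apply hN
    refine Submodule.eq_bot_of_le_smul_of_le_jacobson_bot (Ideal.span {(p : ℤ_[p])}) N
      (IsNoetherian.noetherian N) ?_ ?_
    · intro x hx
      obtain ⟨x', hx', rfl⟩ := hG x hx (fun y hy => hcon x hx y hy)
      exact Submodule.smul_mem_smul (Ideal.mem_span_singleton_self _) hx'
    · rw [← PadicInt.maximalIdeal_eq_span_p]
      exact (IsLocalRing.jacobson_eq_maximalIdeal ⊥ bot_ne_top).ge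
  have hall : ∀ x ∈ N, ∀ y ∈ N, (p : ℤ_[p]) ^ (Nat.find hex) ∣ B x y := by
    intro x hx y hy
    rcases Nat.eq_zero_or_pos (Nat.find hex) with h0 | h0
    · rw [h0]; simp
    · have hcon := Nat.find_min hex (Nat.sub_lt h0 one_pos)
      push Not at hcon
      have := hcon x hx y hy
      rwa [show Nat.find hex - 1 + 1 = Nat.find hex by omega] at this
  obtain ⟨x, hx, y, hy, h⟩ := Nat.find_spec hex
  exact ⟨_, hle, hall, x, hx, y, hy, unit_of_pow (hall x hx y hy) h⟩

/-- a vector, or an even pair -/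
lemma step2 {e : ℕ} {B : LinearMap.BilinForm ℤ_[p] (V3 p)} (hs : ∀ x y, B x y = B y x)
    {N : Submodule ℤ_[p] (V3 p)}
    (hN : N ≠ ⊥) (hG : Good e B N) :
    ∃ a ≤ e, (∀ x ∈ N, ∀ y ∈ N, (p : ℤ_[p]) ^ a ∣ B x y) ∧
      ((∃ x ∈ N, ∃ u, IsUnit u ∧ B x x = (p : ℤ_[p]) ^ a * u) ∨
      (p = 2 ∧ ∃ x ∈ N, ∃ y ∈ N, ∃ u s t, IsUnit u ∧ B x y = (p : ℤ_[p]) ^ a * u ∧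
        B x x = (p : ℤ_[p]) ^ a * (2 * s) ∧ B y y = (p : ℤ_[p]) ^ a * (2 * t))) := by
  obtain ⟨a, hae, hall, x, hx, y, hy, u, hu, hxy⟩ := step hN hG
  refine ⟨a, hae, hall, ?_⟩
  obtain ⟨s, hxx⟩ := hall x hx x hx
  obtain ⟨t, hyy⟩ := hall y hy y hy
  rcases isUnit_or s with hsu | hsd
  · exact Or.inl ⟨x, hx, s, hsu, hxx⟩
  rcases isUnit_or t with htu | htd
  · exact Or.inl ⟨y, hy, t, htu, hyy⟩
  by_cases hp : p = 2
  · subst hp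
    obtain ⟨s', rfl⟩ := hsd
    obtain ⟨t', rfl⟩ := htd
    exact Or.inr ⟨rfl, x, hx, y, hy, u, s', t', hu, hxy, by simpa using hxx, by simpa using hyy⟩
  · left
    refine ⟨x + y, N.add_mem hx hy, s + t + 2 * u, unit_of_ndvd fun h => ?_, ?_⟩
    · apply unit_ndvd ((two_unit hp).mul hu)
      simpa using dvd_sub h (dvd_add hsd htd)
    · simp only [map_add, LinearMap.add_apply, hs y x, hxx, hyy, hxy]
      ring

/-- orthogonal complement of `v` in `N` -/
noncomputable def perp (B : LinearMap.BilinForm ℤ_[p] (V3 p)) (N : Submodule ℤ_[p] (V3 p)) (v : V3 p) :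
    Submodule ℤ_[p] (V3 p) := N ⊓ LinearMap.ker (B v)

lemma mem_perp {B : LinearMap.BilinForm ℤ_[p] (V3 p)} {N : Submodule ℤ_[p] (V3 p)} {v x : V3 p} :
    x ∈ perp B N v ↔ x ∈ N ∧ B v x = 0 := by
  simp [perp]

lemma good_perp {e a : ℕ} {B : LinearMap.BilinForm ℤ_[p] (V3 p)} (hs : ∀ x y, B x y = B y x)
    {N : Submodule ℤ_[p] (V3 p)} (hG : Good e B N)
    (hall : ∀ x ∈ N, ∀ y ∈ N, (p : ℤ_[p]) ^ a ∣ B x y) {v : V3 p} (hv : v ∈ N) {u : ℤ_[p]}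
    (hu : IsUnit u) (hvv : B v v = (p : ℤ_[p]) ^ a * u) : Good e B (perp B N v) := by
  intro x hx H
  rw [mem_perp] at hx
  obtain ⟨x', hx', rfl⟩ := hG x hx.1 (by
    intro y hy
    obtain ⟨k, hk⟩ := hall v hv y hy
    obtain ⟨u, rfl⟩ := hu
    have hm := u.mul_inv
    have := H (y - (k * (u⁻¹ : ℤ_[p]ˣ)) • v) (by
      rw [mem_perp]
      refine ⟨N.sub_mem hy (N.smul_mem _ hv), ?_⟩
      simp only [map_sub, map_smul, smul_eq_mul, hvv, hk]
      linear_combination (-(p : ℤ_[p]) ^ a * k) * hm)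
    have hxv : B x v = 0 := by rw [hs, hx.2]
    simpa [hxv] using this)
  refine ⟨x', ?_, rfl⟩
  rw [mem_perp]
  refine ⟨hx', ?_⟩
  have := hx.2
  simp only [map_smul, smul_eq_mul, mul_eq_zero] at this
  exact this.resolve_left p_ne

lemma good_perp2 {e a : ℕ} {B : LinearMap.BilinForm ℤ_[p] (V3 p)} (hs : ∀ x y, B x y = B y x)
    {N : Submodule ℤ_[p] (V3 p)} (hG : Good e B N)
    (hall : ∀ x ∈ N, ∀ y ∈ N, (p : ℤ_[p]) ^ a ∣ B x y) {v w : V3 p} (hv : v ∈ N) (hw : w ∈ N)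
    {u s t : ℤ_[p]}
    (hu : IsUnit (s * t - u ^ 2)) (hvw : B v w = (p : ℤ_[p]) ^ a * u)
    (hvv : B v v = (p : ℤ_[p]) ^ a * s) (hww : B w w = (p : ℤ_[p]) ^ a * t) :
    Good e B (perp B (perp B N v) w) := by
  intro x hx H
  rw [mem_perp, mem_perp] at hx
  obtain ⟨⟨hx1, hx2⟩, hx3⟩ := hx
  obtain ⟨x', hx', rfl⟩ := hG x hx1 (by
    intro y hy
    obtain ⟨k, hk⟩ := hall v hv y hy
    obtain ⟨l, hl⟩ := hall w hw y hy
    obtain ⟨d, hd⟩ := hu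
    have hm := d.mul_inv
    have hwv : B w v = (p : ℤ_[p]) ^ a * u := by rw [hs, hvw]
    rw [hd] at hm
    have := H (y - (((d⁻¹ : ℤ_[p]ˣ) : ℤ_[p]) * (t * k - u * l)) • v
        - (((d⁻¹ : ℤ_[p]ˣ) : ℤ_[p]) * (s * l - u * k)) • w) (by
      rw [mem_perp, mem_perp]
      refine ⟨⟨N.sub_mem (N.sub_mem hy (N.smul_mem _ hv)) (N.smul_mem _ hw), ?_⟩, ?_⟩
      · simp only [map_sub, map_smul, smul_eq_mul, hvv, hvw, hk]
        linear_combination (-(p : ℤ_[p]) ^ a * k) * hm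
      · simp only [map_sub, map_smul, smul_eq_mul, hww, hwv, hl]
        linear_combination (-(p : ℤ_[p]) ^ a * l) * hm)
    have hxv : B x v = 0 := by rw [hs, hx2]
    have hxw : B x w = 0 := by rw [hs, hx3]
    simpa [hxv, hxw] using this)
  refine ⟨x', ?_, rfl⟩
  rw [mem_perp, mem_perp]
  simp only [map_smul, smul_eq_mul, mul_eq_zero] at hx2 hx3
  exact ⟨⟨hx', hx2.resolve_left p_ne⟩, hx3.resolve_left p_ne⟩

lemma perp_ne (B : LinearMap.BilinForm ℤ_[p] (V3 p)) (v w : V3 p) :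
    perp B (perp B ⊤ v) w ≠ ⊥ := by
  intro h
  have := le_of_fin_injective ℤ_[p] (n := 3) (m := 2)
    (LinearMap.pi ![B v, B w]) (by
      rw [← LinearMap.ker_eq_bot, eq_bot_iff, ← h]
      intro x hx
      rw [LinearMap.mem_ker] at hx
      rw [mem_perp, mem_perp]
      exact ⟨⟨trivial, by simpa using congrFun hx 0⟩, by simpa using congrFun hx 1⟩)
  omega

lemma perp_ne1 (B : LinearMap.BilinForm ℤ_[p] (V3 p)) (v : V3 p) : perp B ⊤ v ≠ ⊥ := by
  intro h
  apply perp_ne B v v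
  rw [h]
  simp [perp]

lemma top_ne : (⊤ : Submodule ℤ_[p] (V3 p)) ≠ ⊥ := by
  intro h
  apply perp_ne1 (0 : LinearMap.BilinForm ℤ_[p] (V3 p)) 0
  rw [h]
  simp [perp]

lemma four_dep (v : Fin 4 → V3 p) : ∃ g : Fin 4 → ℤ_[p], g ≠ 0 ∧
    g 0 • v 0 + g 1 • v 1 + g 2 • v 2 + g 3 • v 3 = 0 := by
  by_contra hcon
  push Not at hcon
  have := le_of_fin_injective ℤ_[p] (n := 4) (m := 3) (Fintype.linearCombination ℤ_[p] v) (by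
    rw [← LinearMap.ker_eq_bot, eq_bot_iff]
    intro g hg
    rw [LinearMap.mem_ker, Fintype.linearCombination_apply, Fin.sum_univ_four] at hg
    by_contra hne
    exact hcon g (by simpa using hne) hg)
  omega

lemma pair_zero {a : ℕ} {α β u s t : ℤ_[p]} (hu : IsUnit (s * t - u ^ 2))
    (h1 : α * ((p : ℤ_[p]) ^ a * s) + β * ((p : ℤ_[p]) ^ a * u) = 0)
    (h2 : α * ((p : ℤ_[p]) ^ a * u) + β * ((p : ℤ_[p]) ^ a * t) = 0) : α = 0 ∧ β = 0 := by
  have hp : (p : ℤ_[p]) ^ a * (s * t - u ^ 2) ≠ 0 := mul_ne_zero (pow_ne_zero _ p_ne) hu.ne_zero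
  constructor
  · apply (mul_eq_zero.1 (?_ : α * ((p : ℤ_[p]) ^ a * (s * t - u ^ 2)) = 0)).resolve_right hp
    linear_combination t * h1 - u * h2
  · apply (mul_eq_zero.1 (?_ : β * ((p : ℤ_[p]) ^ a * (s * t - u ^ 2)) = 0)).resolve_right hp
    linear_combination s * h2 - u * h1

lemma even_disc {u s t : ℤ_[2]} (hu : IsUnit u) : IsUnit ((2 * s) * (2 * t) - u ^ 2) := by
  apply unit_of_ndvd
  intro h
  apply unit_ndvd (hu.pow 2)
  have : ((2 : ℕ) : ℤ_[2]) ∣ (2 * s) * (2 * t) := ⟨s * (2 * t), by push_cast; ring⟩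
  simpa using dvd_sub this h

def DiagT (e : ℕ) (B : LinearMap.BilinForm ℤ_[p] (V3 p)) : Prop :=
  ∃ x y z : V3 p, B x y = 0 ∧ B x z = 0 ∧ B y z = 0 ∧ ∃ a ≤ e, ∃ b ≤ e, ∃ c ≤ e, ∃ u v w,
    IsUnit u ∧ IsUnit v ∧ IsUnit w ∧ B x x = (p : ℤ_[p]) ^ a * u ∧ B y y = (p : ℤ_[p]) ^ b * v ∧
      B z z = (p : ℤ_[p]) ^ c * w

def EvenT (e : ℕ) (B : LinearMap.BilinForm ℤ_[p] (V3 p)) : Prop :=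
  p = 2 ∧ ∃ x y z : V3 p, B x z = 0 ∧ B y z = 0 ∧ ∃ a ≤ e, ∃ b ≤ e, ∃ u w s t,
    IsUnit u ∧ IsUnit w ∧ B x y = (p : ℤ_[p]) ^ a * u ∧ B x x = (p : ℤ_[p]) ^ a * (2 * s) ∧
    B y y = (p : ℤ_[p]) ^ a * (2 * t) ∧ B z z = (p : ℤ_[p]) ^ b * w

lemma jordan {e : ℕ} {B : LinearMap.BilinForm ℤ_[p] (V3 p)} (hs : ∀ x y, B x y = B y x)
    (hG : Good e B ⊤) : DiagT e B ∨ EvenT e B := by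
  obtain ⟨a, hae, hall, ⟨x, hx, u, hu, hxx⟩ | ⟨hp, x, hx, y, hy, u, s, t, hu, hxy, hxx, hyy⟩⟩ :=
    step2 hs top_ne hG
  · have hG1 := good_perp hs hG hall hx hu hxx
    obtain ⟨b, hbe, hall1, ⟨y, hy, v, hv, hyy⟩ |
      ⟨hp, y, hy, z, hz, v, s, t, hv, hyz, hyy, hzz⟩⟩ := step2 hs (perp_ne1 B x) hG1
    · have hG2 := good_perp hs hG1 hall1 hy hv hyy
      obtain ⟨c, hce, hall2, ⟨z, hz, w, hw, hzz⟩ |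
        ⟨hp, z, hz, z', hz', v', s, t, hv', hzz', hzz, hz'z'⟩⟩ := step2 hs (perp_ne B x y) hG2
      · rw [mem_perp] at hy
        rw [mem_perp, mem_perp] at hz
        exact Or.inl ⟨x, y, z, hy.2, hz.1.2, hz.2, a, hae, b, hbe, c, hce, u, v, w, hu, hv, hw,
          hxx, hyy, hzz⟩
      · rw [mem_perp, mem_perp] at hz hz'
        right
        refine ⟨hp, z, z', x, ?_, ?_, c, hce, a, hae, v', u, s, t, hv', hu, hzz', hzz, hz'z', hxx⟩
        · rw [hs]; exact hz.1.2
        · rw [hs]; exact hz'.1.2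
    · rw [mem_perp] at hy hz
      right
      refine ⟨hp, y, z, x, ?_, ?_, b, hbe, a, hae, v, u, s, t, hv, hu, hyz, hyy, hzz, hxx⟩
      · rw [hs]; exact hy.2
      · rw [hs]; exact hz.2
  · subst hp
    have hG2 := good_perp2 hs hG hall hx hy (even_disc (s := s) (t := t) hu) hxy hxx hyy
    obtain ⟨c, hce, hall2, ⟨z, hz, w, hw, hzz⟩ |
      ⟨-, z, hz, z', hz', v', s', t', hv', hzz', hzz, hz'z'⟩⟩ := step2 hs (perp_ne B x y) hG2
    · rw [mem_perp, mem_perp] at hz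
      exact Or.inr ⟨rfl, x, y, z, hz.1.2, hz.2, a, hae, c, hce, u, w, s, t, hu, hw, hxy, hxx,
        hyy, hzz⟩
    · exfalso
      rw [mem_perp, mem_perp] at hz hz'
      obtain ⟨g, hg, hd⟩ := four_dep ![x, y, z, z']
      simp only [Matrix.cons_val] at hd
      have hyx := (hs y x).trans hxy
      have hz'z := (hs z' z).trans hzz'
      have hzx := (hs z x).trans hz.1.2
      have hzy := (hs z y).trans hz.2
      have hz'x := (hs z' x).trans hz'.1.2
      have hz'y := (hs z' y).trans hz'.2
      have E1 := congrArg (B x) hd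
      have E2 := congrArg (B y) hd
      have E3 := congrArg (B z) hd
      have E4 := congrArg (B z') hd
      simp only [map_add, map_smul, smul_eq_mul, map_zero, hxx, hxy, hyx, hyy, hz.1.2, hz.2,
        hz'.1.2, hz'.2, hzz, hzz', hz'z, hz'z', hzx, hzy, hz'x, hz'y, mul_zero, add_zero,
        zero_add] at E1 E2 E3 E4
      obtain ⟨g0, g1⟩ := pair_zero (even_disc (s := s) (t := t) hu) E1 E2
      obtain ⟨g2, g3⟩ := pair_zero (even_disc (s := s') (t := t') hv') E3 E4
      apply hg
      funext i
      fin_cases i <;> assumption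

lemma scale_ex {a e : ℕ} (h : a ≤ e) : ∃ k f : ℤ_[p], (f = 1 ∨ f = p) ∧
    (p : ℤ_[p]) * (k ^ 2 * (p : ℤ_[p]) ^ a) = (p : ℤ_[p]) ^ e * f := by
  obtain ⟨m, rfl⟩ := Nat.exists_eq_add_of_le h
  obtain ⟨k, hk | hk⟩ := Nat.even_or_odd' m
  · exact ⟨(p : ℤ_[p]) ^ k, p, Or.inr rfl, by rw [hk]; ring⟩
  · exact ⟨(p : ℤ_[p]) ^ k, 1, Or.inl rfl, by rw [hk]; ring⟩

lemma fin_diag {e : ℕ} {B : LinearMap.BilinForm ℤ_[p] (V3 p)} (hs : ∀ x y, B x y = B y x)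
    (h : DiagT e B) (ε c : ℤ_[p]) (hε : IsUnit ε) :
    ∃ (v : V3 p) (t : ℤ_[p]), B v v + (p : ℤ_[p]) ^ e * ε * t ^ 2 = (p : ℤ_[p]) ^ e * c := by
  obtain ⟨x, y, z, hxy, hxz, hyz, a, ha, b, hb, d, hd, u, v, w, hu, hv, hw, hxx, hyy, hzz⟩ := h
  obtain ⟨k₁, f₁, hf₁, e₁⟩ := scale_ex (p := p) ha
  obtain ⟨k₂, f₂, hf₂, e₂⟩ := scale_ex (p := p) hb
  obtain ⟨k₃, f₃, hf₃, e₃⟩ := scale_ex (p := p) hd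
  have core : ∃ x y z t, (f₁ * u) * x ^ 2 + (f₂ * v) * y ^ 2 + (f₃ * w) * z ^ 2
      + p * ε * t ^ 2 = p * c := by
    have g₁ : f₁ * u = u ∨ f₁ * u = p * u := by rcases hf₁ with rfl | rfl <;> simp
    have g₂ : f₂ * v = v ∨ f₂ * v = p * v := by rcases hf₂ with rfl | rfl <;> simp
    have g₃ : f₃ * w = w ∨ f₃ * w = p * w := by rcases hf₃ with rfl | rfl <;> simp
    by_cases hp : p = 2
    · subst hp
      exact core_two u v w ε c _ _ _ hu hv hw hε g₁ g₂ g₃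
    · exact core_odd hp u v w ε c _ _ _ hu hv hw hε g₁ g₂ g₃
  obtain ⟨X, Y, Z, T, H⟩ := core
  refine ⟨(X * k₁) • x + (Y * k₂) • y + (Z * k₃) • z, T, ?_⟩
  apply mul_left_cancel₀ (p_ne (p := p))
  have hyx := (hs y x).trans hxy
  have hzx := (hs z x).trans hxz
  have hzy := (hs z y).trans hyz
  simp only [map_add, map_smul, LinearMap.add_apply, LinearMap.smul_apply, smul_eq_mul, hxx, hyy,
    hzz, hxy, hxz, hyz, hyx, hzx, hzy]
  linear_combination (p : ℤ_[p]) ^ e * H + X ^ 2 * u * e₁ + Y ^ 2 * v * e₂ + Z ^ 2 * w * e₃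

lemma fin_even {e : ℕ} {B : LinearMap.BilinForm ℤ_[p] (V3 p)} (hs : ∀ x y, B x y = B y x)
    (h : EvenT e B) (ε c : ℤ_[p]) (hε : IsUnit ε) :
    ∃ (v : V3 p) (t : ℤ_[p]), B v v + (p : ℤ_[p]) ^ e * ε * t ^ 2 = (p : ℤ_[p]) ^ e * c := by
  obtain ⟨rfl, x, y, z, hxz, hyz, a, ha, b, hb, u, w, s, t, hu, hw, hxy, hxx, hyy, hzz⟩ := h
  obtain ⟨k₁, f₁, hf₁, e₁⟩ := scale_ex (p := 2) ha
  obtain ⟨k₃, f₃, hf₃, e₃⟩ := scale_ex (p := 2) hb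
  have g₃ : f₃ * w = w ∨ f₃ * w = (2 : ℕ) * w := by rcases hf₃ with rfl | rfl <;> simp
  obtain ⟨X, Y, Z, T, H⟩ := core_even s u t w ε c (f₃ * w) f₁ hu hw hε hf₁ g₃
  refine ⟨(X * k₁) • x + (Y * k₁) • y + (Z * k₃) • z, T, ?_⟩
  apply mul_left_cancel₀ (p_ne (p := 2))
  have hyx := (hs y x).trans hxy
  have hzx := (hs z x).trans hxz
  have hzy := (hs z y).trans hyz
  simp only [map_add, map_smul, LinearMap.add_apply, LinearMap.smul_apply, smul_eq_mul, hxx, hyy,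
    hzz, hxy, hxz, hyz, hyx, hzx, hzy]
  linear_combination ((2 : ℕ) : ℤ_[2]) ^ e * H
    + 2 * (s * X ^ 2 + u * X * Y + t * Y ^ 2) * e₁ + Z ^ 2 * w * e₃

lemma good_top (e : ℕ) (G : Matrix (Fin 3) (Fin 3) ℤ_[p]) (hsym : G.IsSymm) (hdet : G.det ≠ 0)
    (hlast : ∀ x y : Fin 3 → ℚ_[p], InDual p G x → InDual p G y →
      ‖(p : ℚ_[p]) ^ e * (x ⬝ᵥ (G.map ((↑) : ℤ_[p] → ℚ_[p])).mulVec y)‖ ≤ 1) :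
    Good e (Matrix.toBilin' G) ⊤ := by
  intro x _ H
  have hp0 : (p : ℚ_[p]) ≠ 0 := by exact_mod_cast (Fact.out : p.Prime).ne_zero
  set G' := G.map ((↑) : ℤ_[p] → ℚ_[p]) with hG'
  have hcoe : ∀ a b : V3 p, ((a ⬝ᵥ G.mulVec b : ℤ_[p]) : ℚ_[p])
      = (fun i => (a i : ℚ_[p])) ⬝ᵥ G'.mulVec (fun i => (b i : ℚ_[p])) := by
    intro a b
    simp [dotProduct, Matrix.mulVec, PadicInt.coe_sum]
    rfl
  have hdet' : IsUnit G'.det := by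
    have : G'.det = ((G.det : ℤ_[p]) : ℚ_[p]) := by
      have := (RingHom.map_det (PadicInt.Coe.ringHom (p := p)) G)
      exact this.symm
    rw [this, isUnit_iff_ne_zero]
    intro h0
    exact hdet (Subtype.ext h0)
  have hsym' : G'ᵀ = G' := by
    ext i j
    exact congrArg (fun z : ℤ_[p] => (z : ℚ_[p])) (congrFun (congrFun hsym.eq i) j)
  have hx : InDual p G (fun i => ((p : ℚ_[p]) ^ (e + 1))⁻¹ * (x i : ℚ_[p])) := by
    intro z
    obtain ⟨k, hk⟩ := H z trivial
    rw [Matrix.toBilin'_apply'] at hk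
    have h1 := hcoe x z
    rw [hk] at h1
    have h2 : (fun i => ((p : ℚ_[p]) ^ (e + 1))⁻¹ * (x i : ℚ_[p]))
        = ((p : ℚ_[p]) ^ (e + 1))⁻¹ • (fun i => (x i : ℚ_[p])) := rfl
    rw [h2, smul_dotProduct, ← h1]
    push_cast
    rw [smul_eq_mul, inv_mul_cancel_left₀ (pow_ne_zero _ hp0)]
    exact PadicInt.norm_le_one k
  have hdvd : ∀ i, ∃ k : ℤ_[p], x i = p * k := by
    intro i
    have hy : InDual p G (G'⁻¹.mulVec (Pi.single i 1)) := by
      intro z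
      rw [← hG', Matrix.dotProduct_mulVec, ← Matrix.mulVec_transpose, hsym', Matrix.mulVec_mulVec,
        Matrix.mul_nonsing_inv _ hdet', Matrix.one_mulVec, single_dotProduct, one_mul]
      exact PadicInt.norm_le_one _
    have h1 := hlast _ _ hx hy
    have h2 : (fun i => ((p : ℚ_[p]) ^ (e + 1))⁻¹ * (x i : ℚ_[p]))
        = ((p : ℚ_[p]) ^ (e + 1))⁻¹ • (fun i => (x i : ℚ_[p])) := rfl
    rw [Matrix.mulVec_mulVec, Matrix.mul_nonsing_inv _ hdet', Matrix.one_mulVec, h2,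
      smul_dotProduct, dotProduct_single, mul_one, smul_eq_mul] at h1
    obtain ⟨k, hk⟩ : ∃ k : ℤ_[p], (k : ℚ_[p])
        = (p : ℚ_[p]) ^ e * (((p : ℚ_[p]) ^ (e + 1))⁻¹ * (x i : ℚ_[p])) := ⟨⟨_, h1⟩, rfl⟩
    refine ⟨k, PadicInt.ext ((?_ : (x i : ℚ_[p]) = p * (k : ℚ_[p])).trans ?_)⟩
    · rw [hk, ← mul_assoc, ← pow_succ', mul_inv_cancel_left₀ (pow_ne_zero _ hp0)]
    · exact (PadicInt.coe_mul (p : ℤ_[p]) k).symm ▸ rfl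
  choose k hk using hdvd
  exact ⟨k, trivial, funext hk⟩

end geom

/-- If the scale of the last Jordan component of a ternary `ℤ_p`-lattice `L₁` contains
`p^e ℤ_p` (equivalently, the scale of the dual of `L₁` is contained in `p^{-e}ℤ_p`),
then `L₁ ⊥ ⟨p^e ε⟩` represents every element of `p^e ℤ_p`. -/
theorem stmt_3 (p : ℕ) [Fact p.Prime] (e : ℕ) (ε : ℤ_[p]ˣ)
    (G : Matrix (Fin 3) (Fin 3) ℤ_[p]) (hsym : G.IsSymm) (hdet : G.det ≠ 0)
    (hlast : ∀ x y : Fin 3 → ℚ_[p], InDual p G x → InDual p G y →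
      ‖(p : ℚ_[p]) ^ e * (x ⬝ᵥ (G.map ((↑) : ℤ_[p] → ℚ_[p])).mulVec y)‖ ≤ 1) :
    ∀ c : ℤ_[p], ∃ (v : Fin 3 → ℤ_[p]) (t : ℤ_[p]),
      v ⬝ᵥ G.mulVec v + (p : ℤ_[p]) ^ e * ε * t ^ 2 = (p : ℤ_[p]) ^ e * c := by
  intro c
  have hs : ∀ x y, Matrix.toBilin' G x y = Matrix.toBilin' G y x := by
    intro x y
    rw [Matrix.toBilin'_apply', Matrix.toBilin'_apply', Matrix.dotProduct_mulVec,
      dotProduct_comm, ← Matrix.mulVec_transpose, hsym.eq]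
  have hG := good_top e G hsym hdet hlast
  obtain ⟨v, t, h⟩ : ∃ (v : V3 p) (t : ℤ_[p]), Matrix.toBilin' G v v
      + (p : ℤ_[p]) ^ e * ε * t ^ 2 = (p : ℤ_[p]) ^ e * c := by
    rcases jordan hs hG with h | h
    · exact fin_diag hs h ε c ε.isUnit
    · exact fin_even hs h ε c ε.isUnit
  rw [Matrix.toBilin'_apply'] at h
  exact ⟨v, t, h⟩
end
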